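/- arXiv:2509.19935 — 4 statements merged into one kernel-verified Lean document; each statement's English description precedes it below -/
import Mathlib

section
/- Let n be a positive integer, let 0 < x ≤ b, and set β = ⌈nb⌉/n. Then P(N_{nx} ≥ nb) ≤ R_n(x,β)·exp(−n·H(β,x)), where R_n(x,β) = min( x/((β − x + 1/n)·√(2πnβ)), 1/2 ) + 1/√(2πnβ). -/
open Real

/-- Poisson probability mass function with mean `lam`: `P(N_lam = k)`. -/
noncomputable def poissonProb (lam : ℝ) (k : ℕ) : ℝ := lam ^ k * Real.exp (-lam) / k.factorial

/-- Kullback–Leibler divergence between Poisson random variables with means `t` and `x`. -/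
noncomputable def H (t x : ℝ) : ℝ := t * Real.log (t / x) - t + x

lemma poissonProb_nonneg {lam : ℝ} (h : 0 ≤ lam) (k : ℕ) : 0 ≤ poissonProb lam k := by
  unfold poissonProb
  positivity

lemma hasSum_poissonProb (lam : ℝ) : HasSum (poissonProb lam) 1 := by
  have h := (NormedSpace.expSeries_div_hasSum_exp (𝔸 := ℝ) lam).mul_right (Real.exp (-lam))
  rw [← Real.exp_eq_exp_ℝ, ← Real.exp_add, add_neg_cancel, Real.exp_zero] at h
  have heq : poissonProb lam = fun k : ℕ => lam ^ k / k.factorial * Real.exp (-lam) := by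
    ext k
    unfold poissonProb
    ring
  exact heq ▸ h

lemma summable_poissonProb_add (lam : ℝ) (m : ℕ) : Summable fun j => poissonProb lam (m + j) := by
  simpa only [add_comm] using (summable_nat_add_iff m).2 (hasSum_poissonProb lam).summable

lemma tsum_ite_le_poissonProb (lam : ℝ) (m : ℕ) :
    (∑' k : ℕ, if m ≤ k then poissonProb lam k else 0) = ∑' j, poissonProb lam (m + j) := by
  have hs : Summable fun k : ℕ => if m ≤ k then poissonProb lam k else 0 := by
    refine (summable_nat_add_iff m).1 ?_
    simpa [add_comm] using summable_poissonProb_add lam m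
  rw [← hs.sum_add_tsum_nat_add m, Finset.sum_eq_zero, zero_add]
  · simp [add_comm]
  · intro k hk
    simp [Finset.mem_range.1 hk]

/-- The upper tail of a Poisson variable is dominated by a geometric series. -/
lemma tsum_poissonProb_add_le {lam : ℝ} (h0 : 0 ≤ lam) {m : ℕ} (hm : lam < m + 1) :
    ∑' j, poissonProb lam (m + j) ≤ poissonProb lam m * (lam / (m + 1 - lam) + 1) := by
  have hr0 : 0 ≤ lam / (m + 1) := by positivity
  have hr1 : lam / (m + 1) < 1 := (div_lt_one (by positivity)).2 hm
  have hgeo := (hasSum_geometric_of_lt_one hr0 hr1).mul_left (poissonProb lam m)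
  have hle : ∀ j, poissonProb lam (m + j) ≤ poissonProb lam m * (lam / (m + 1)) ^ j := by
    intro j
    have hfac : (m.factorial : ℝ) * (m + 1) ^ j ≤ (m + j).factorial := by
      exact_mod_cast Nat.factorial_mul_pow_le_factorial
    unfold poissonProb
    calc lam ^ (m + j) * Real.exp (-lam) / (m + j).factorial
        ≤ lam ^ (m + j) * Real.exp (-lam) / ((m.factorial : ℝ) * (m + 1) ^ j) := by gcongr
      _ = _ := by rw [div_pow, pow_add]; field_simp
  have h := (summable_poissonProb_add lam m).tsum_le_tsum hle hgeo.summable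
  rw [hgeo.tsum_eq] at h
  refine h.trans_eq ?_
  have : (m : ℝ) + 1 - lam ≠ 0 := by linarith
  congr 1
  field_simp
  ring

/-- Comparison of the upper tail from `m` with that of the Poisson variable of mean `m`. -/
lemma tsum_poissonProb_add_le_mul {lam : ℝ} (h0 : 0 ≤ lam) {m : ℕ} (hm0 : 0 < m) (hm : lam ≤ m) :
    ∑' j, poissonProb lam (m + j) ≤
      (∑' j, poissonProb m (m + j)) * ((lam / m) ^ m * Real.exp (m - lam)) := by
  rw [← tsum_mul_right]
  refine (summable_poissonProb_add lam m).tsum_le_tsum ?_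
    ((summable_poissonProb_add m m).mul_right _)
  intro j
  have hm' : (0 : ℝ) < m := by exact_mod_cast hm0
  unfold poissonProb
  calc lam ^ (m + j) * Real.exp (-lam) / (m + j).factorial
      ≤ lam ^ m * (m : ℝ) ^ j * Real.exp (-lam) / (m + j).factorial := by
        rw [pow_add]; gcongr
    _ = _ := by
        rw [div_pow, pow_add, sub_eq_add_neg, Real.exp_add, Real.exp_neg (m : ℝ)]
        field_simp

lemma one_sub_mul_exp_le {u : ℝ} (hu : 0 ≤ u) :
    (1 - u) * Real.exp u ≤ (1 + u) * Real.exp (-u) := by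
  have hd : ∀ v : ℝ, HasDerivAt (fun v => (1 + v) * Real.exp (-v) - (1 - v) * Real.exp v)
      (v * (Real.exp v - Real.exp (-v))) v := by
    intro v
    have h1 := ((hasDerivAt_id v).const_add 1).mul (hasDerivAt_neg v).exp
    have h2 := ((hasDerivAt_id v).const_sub 1).mul (Real.hasDerivAt_exp v)
    refine (h1.sub h2).congr_deriv ?_
    simp only [id]
    ring
  have hmono : MonotoneOn (fun v => (1 + v) * Real.exp (-v) - (1 - v) * Real.exp v)
      (Set.Ici 0) := by
    refine monotoneOn_of_deriv_nonneg (convex_Ici 0)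
      (fun v _ => (hd v).continuousAt.continuousWithinAt)
      (fun v _ => (hd v).differentiableAt.differentiableWithinAt) ?_
    intro v hv
    rw [interior_Ici, Set.mem_Ioi] at hv
    rw [(hd v).deriv]
    exact mul_nonneg hv.le (sub_nonneg.2 (Real.exp_le_exp.2 (by linarith)))
  have := hmono (Set.mem_Ici.2 le_rfl) (Set.mem_Ici.2 hu) hu
  simp at this
  linarith

/-- Around its mode `m`, the function `t ↦ t ^ m * exp (-t)` is larger on the right. -/
lemma poissonProb_sub_le_add {m : ℕ} (hm : 0 < m) {s : ℝ} (h0 : 0 ≤ s) (hs : s ≤ m) :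
    poissonProb (m - s) m ≤ poissonProb (m + s) m := by
  have hm' : (0 : ℝ) < m := by exact_mod_cast hm
  have hu := one_sub_mul_exp_le (u := s / m) (by positivity)
  have key : ∀ r : ℝ, (m + r) ^ m * Real.exp (-(m + r)) =
      (m : ℝ) ^ m * Real.exp (-m) * ((1 + r / m) * Real.exp (-(r / m))) ^ m := by
    intro r
    rw [mul_pow, ← Real.exp_nat_mul, neg_add, Real.exp_add,
      show (m : ℝ) * -(r / m) = -r by field_simp,
      show (m : ℝ) + r = m * (1 + r / m) by field_simp, mul_pow]
    ring
  have hle : (m - s) ^ m * Real.exp (-(m - s)) ≤ (m + s) ^ m * Real.exp (-(m + s)) := by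
    have h1 := key (-s)
    rw [neg_div, neg_neg, ← sub_eq_add_neg, ← sub_eq_add_neg] at h1
    rw [key s, h1]
    have : 0 ≤ 1 - s / m := sub_nonneg.2 ((div_le_one hm').2 hs)
    gcongr
  unfold poissonProb
  gcongr

lemma hasDerivAt_sum_poissonProb (m : ℕ) (t : ℝ) :
    HasDerivAt (fun t => ∑ k ∈ Finset.range (m + 1), poissonProb t k) (-poissonProb t m) t := by
  have hone : ∀ k : ℕ, HasDerivAt (fun t => poissonProb t k)
      (k * t ^ (k - 1) * Real.exp (-t) / k.factorial - poissonProb t k) t := by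
    intro k
    have h := ((hasDerivAt_pow k t).mul (hasDerivAt_neg t).exp).div_const (k.factorial : ℝ)
    refine h.congr_deriv ?_
    unfold poissonProb
    ring
  induction m with
  | zero => simpa using hone 0
  | succ m ih =>
    rw [funext fun t => Finset.sum_range_succ (poissonProb t) (m + 1)]
    refine (ih.add (hone (m + 1))).congr_deriv ?_
    unfold poissonProb
    rw [Nat.factorial_succ]
    push_cast
    field_simp
    ring

/-- The Poisson distribution of integer mean `m` puts mass at least one half on `[0, m]`. -/
lemma half_le_sum_poissonProb {m : ℕ} (hm : 0 < m) :
    1 / 2 ≤ ∑ k ∈ Finset.range (m + 1), poissonProb m k := by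
  set F : ℝ → ℝ := fun t => ∑ k ∈ Finset.range (m + 1), poissonProb t k with hF
  have hd : ∀ s, HasDerivAt (fun s => F (m - s) + F (m + s))
      (poissonProb (m - s) m - poissonProb (m + s) m) s := by
    intro s
    have h1 := (hasDerivAt_sum_poissonProb m (m - s)).comp s ((hasDerivAt_id s).const_sub (m : ℝ))
    have h2 := (hasDerivAt_sum_poissonProb m (m + s)).comp s ((hasDerivAt_id s).const_add (m : ℝ))
    refine (h1.add h2).congr_deriv ?_
    ring
  have hanti : AntitoneOn (fun s => F (m - s) + F (m + s)) (Set.Icc 0 (m : ℝ)) := by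
    refine antitoneOn_of_deriv_nonpos (convex_Icc _ _)
      (fun v _ => (hd v).continuousAt.continuousWithinAt)
      (fun v _ => (hd v).differentiableAt.differentiableWithinAt) ?_
    intro s hs
    rw [interior_Icc, Set.mem_Ioo] at hs
    rw [(hd s).deriv]
    exact sub_nonpos.2 (poissonProb_sub_le_add hm hs.1.le hs.2.le)
  have h := hanti (Set.left_mem_Icc.2 m.cast_nonneg) (Set.right_mem_Icc.2 m.cast_nonneg)
    m.cast_nonneg
  have hF0 : F 0 = 1 := by
    simp [hF, poissonProb, Finset.sum_range_succ']
  have hF2 : 0 ≤ F (m + m) := Finset.sum_nonneg fun k _ => poissonProb_nonneg (by positivity) k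
  simp only [sub_self, sub_zero, add_zero, hF0] at h
  change 1 / 2 ≤ F m
  linarith

lemma tsum_poissonProb_self_le {m : ℕ} (hm : 0 < m) :
    ∑' j, poissonProb m (m + j) ≤ 1 / 2 + poissonProb m m := by
  have h := (hasSum_poissonProb m).summable.sum_add_tsum_nat_add m
  rw [(hasSum_poissonProb m).tsum_eq] at h
  have h2 := half_le_sum_poissonProb hm
  rw [Finset.sum_range_succ] at h2
  simp only [add_comm m]
  linarith

/-- Stirling bound for the Poisson mass function. -/
lemma poissonProb_le_stirling {lam : ℝ} (h0 : 0 ≤ lam) {m : ℕ} (hm : 0 < m) :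
    poissonProb lam m ≤ 1 / √(2 * π * m) * ((lam / m) ^ m * Real.exp (m - lam)) := by
  have hm' : (0 : ℝ) < m := by exact_mod_cast hm
  have hpos : 0 < √(2 * π * m) := Real.sqrt_pos.2 (by positivity)
  unfold poissonProb
  calc lam ^ m * Real.exp (-lam) / m.factorial
      ≤ lam ^ m * Real.exp (-lam) / (√(2 * π * m) * (m / Real.exp 1) ^ m) := by
        gcongr
        exact Stirling.le_factorial_stirling m
    _ = _ := by
        rw [div_pow, div_pow, ← Real.exp_nat_mul, mul_one, sub_eq_add_neg, Real.exp_add]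
        field_simp

theorem poisson_right_tail_upper (n : ℕ) (hn : 0 < n) (x b : ℝ) (hx : 0 < x) (hxb : x ≤ b)
    (β : ℝ) (hβ : β = (⌈(n : ℝ) * b⌉ : ℝ) / n) :
    (∑' k : ℕ, if (n : ℝ) * b ≤ k then poissonProb ((n : ℝ) * x) k else 0) ≤
      (min (x / ((β - x + 1 / n) * Real.sqrt (2 * π * n * β))) (1 / 2)
          + 1 / Real.sqrt (2 * π * n * β)) * Real.exp (-(n : ℝ) * H β x) := by
  have hn' : (0 : ℝ) < n := by exact_mod_cast hn
  have hb : 0 < (n : ℝ) * b := mul_pos hn' (hx.trans_le hxb)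
  set m : ℕ := ⌈(n : ℝ) * b⌉₊ with hm_def
  have hm : 0 < m := Nat.ceil_pos.2 hb
  have hm' : (0 : ℝ) < m := by exact_mod_cast hm
  have hmc : ((⌈(n : ℝ) * b⌉ : ℤ) : ℝ) = m := (natCast_ceil_eq_intCast_ceil hb.le).symm
  have hlam0 : 0 < (n : ℝ) * x := mul_pos hn' hx
  have hlam : (n : ℝ) * x ≤ m := (mul_le_mul_of_nonneg_left hxb hn'.le).trans (Nat.le_ceil _)
  have hnβ : 2 * π * n * β = 2 * π * m := by
    rw [hβ, hmc]; field_simp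
  have hE : Real.exp (-(n : ℝ) * H β x) = (n * x / m) ^ m * Real.exp (m - n * x) := by
    have hpos : 0 < (n : ℝ) * x / m := by positivity
    rw [← Real.exp_log (pow_pos hpos m), ← Real.exp_add, Real.log_pow, H,
      hβ, hmc, show (m : ℝ) / n / x = (n * x / m)⁻¹ by field_simp, Real.log_inv]
    congr 1
    field_simp
    ring
  have hR : x / ((β - x + 1 / n) * √(2 * π * m)) =
      n * x / (m + 1 - n * x) * (1 / √(2 * π * m)) := by
    have h1 : (0 : ℝ) < m + 1 - n * x := by linarith
    have h2 : 0 < √(2 * π * m) := Real.sqrt_pos.2 (by positivity)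
    rw [show β - x + 1 / n = (m + 1 - n * x) / n by rw [hβ, hmc]; field_simp; ring]
    field_simp
  simp only [← Nat.ceil_le, ← hm_def]
  rw [tsum_ite_le_poissonProb, hnβ, hE, hR, min_add]
  rw [min_mul_of_nonneg _ _ (by positivity)]
  refine le_min ?_ ?_
  · have hpos : 0 ≤ n * x / (m + 1 - n * x) := div_nonneg hlam0.le (by linarith)
    calc _ ≤ _ := tsum_poissonProb_add_le hlam0.le (by linarith)
      _ ≤ _ := mul_le_mul_of_nonneg_right (poissonProb_le_stirling hlam0.le hm) (by linarith)
      _ = _ := by ring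
  · refine (tsum_poissonProb_add_le_mul hlam0.le hm hlam).trans ?_
    have h := poissonProb_le_stirling hm'.le hm
    rw [div_self hm'.ne', sub_self, one_pow, Real.exp_zero, mul_one, mul_one] at h
    gcongr
    exact (tsum_poissonProb_self_le hm).trans (by linarith)
end

section
/- Let n be a positive integer, let 1/n ≤ a ≤ x, and set α = ⌊na⌋/n. Then P(N_{nx} ≤ na) ≤ L_n(x,α)·exp(−n·H(α,x)), where L_n(x,α) = min( x/((x − α + 1/n)·√(2πnα)), 1/2 ) + 1/√(2πnα). -/
open Real

/-- In the Poisson distribution of integer mean `m = i + j + 1`, the point `i = m - 1 - j`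
carries no more mass than the mirrored point `m + j`. -/
lemma pow_div_factorial_le_reflect (m j : ℕ) :
    ∀ i : ℕ, m = i + j + 1 →
      (m : ℝ) ^ i / i.factorial ≤ (m : ℝ) ^ (m + j) / (m + j).factorial := by
  induction j with
  | zero =>
    rintro i rfl
    simp only [add_zero, Nat.factorial_succ, pow_succ, Nat.cast_mul]
    refine le_of_eq ?_
    have : ((i : ℝ) + 1) ≠ 0 := by positivity
    push_cast
    field_simp
  | succ j ih =>
    intro i hi
    have h := ih (i + 1) (by omega)
    have hm : (m : ℝ) = i + j + 2 := by rw [hi]; push_cast; ring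
    have hm0 : (0 : ℝ) < m := by rw [hm]; positivity
    have hl : (m : ℝ) ^ i / i.factorial
        = (m : ℝ) ^ (i + 1) / (i + 1).factorial * ((i + 1) / m) := by
      rw [Nat.factorial_succ, pow_succ]
      push_cast
      field_simp
    have hr : (m : ℝ) ^ (m + (j + 1)) / (m + (j + 1)).factorial
        = (m : ℝ) ^ (m + j) / (m + j).factorial * (m / (m + j + 1)) := by
      rw [← add_assoc, Nat.factorial_succ, pow_succ]
      push_cast
      field_simp
    rw [hl, hr]
    refine mul_le_mul h ?_ (by positivity) (by positivity)
    rw [div_le_div_iff₀ hm0 (by positivity)]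
    nlinarith [sq_nonneg ((j : ℝ) + 1)]

/-- A Poisson variable of integer mean `m` is smaller than `m` with probability at most `1/2`. -/
lemma sum_pow_div_factorial_le_half_exp (m : ℕ) :
    ∑ k ∈ Finset.range m, (m : ℝ) ^ k / k.factorial ≤ Real.exp m / 2 := by
  have hexp := Real.sum_le_exp_of_nonneg (Nat.cast_nonneg (α := ℝ) m) (m + m)
  rw [Finset.sum_range_add] at hexp
  have hle : ∑ k ∈ Finset.range m, (m : ℝ) ^ k / k.factorial
      ≤ ∑ j ∈ Finset.range m, (m : ℝ) ^ (m + j) / (m + j).factorial := by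
    rw [← Finset.sum_range_reflect]
    refine Finset.sum_le_sum fun j hj => ?_
    have := Finset.mem_range.mp hj
    exact pow_div_factorial_le_reflect m j (m - 1 - j) (by omega)
  linarith

/-- Comparison of the lower part of the exponential series with a geometric series. -/
lemma sum_pow_div_factorial_mul_le (m : ℕ) {μ : ℝ} (hμ : 0 ≤ μ) :
    (∑ k ∈ Finset.range m, μ ^ k / k.factorial) * (μ - m + 1)
      ≤ m * (μ ^ m / m.factorial) := by
  induction m with
  | zero => simp
  | succ m ih =>
    have hS : 0 ≤ ∑ k ∈ Finset.range m, μ ^ k / (k.factorial : ℝ) :=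
      Finset.sum_nonneg fun _ _ => by positivity
    have ht : ((m + 1 : ℕ) : ℝ) * (μ ^ (m + 1) / (m + 1).factorial)
        = μ * (μ ^ m / m.factorial) := by
      rw [Nat.factorial_succ, pow_succ]
      push_cast
      field_simp
    rw [ht, Finset.sum_range_succ]
    push_cast
    linarith

/-- For `μ ≥ m`, the lower partial sum grows at most like `μ ^ m`. -/
lemma sum_pow_div_factorial_le_half (m : ℕ) (hm : 0 < m) {μ : ℝ} (hμ : (m : ℝ) ≤ μ) :
    ∑ k ∈ Finset.range m, μ ^ k / k.factorial ≤ 1 / 2 * (Real.exp m * (μ / m) ^ m) := by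
  have hm0 : (0 : ℝ) < m := by exact_mod_cast hm
  have h1 : 1 ≤ μ / m := (one_le_div hm0).mpr hμ
  calc ∑ k ∈ Finset.range m, μ ^ k / (k.factorial : ℝ)
      ≤ ∑ k ∈ Finset.range m, (m : ℝ) ^ k / k.factorial * (μ / m) ^ m := by
        refine Finset.sum_le_sum fun k hk => ?_
        have hk' := (Finset.mem_range.mp hk).le
        calc μ ^ k / (k.factorial : ℝ) = (m : ℝ) ^ k / k.factorial * (μ / m) ^ k := by
              rw [div_pow]; field_simp
          _ ≤ _ := by gcongr
    _ = (∑ k ∈ Finset.range m, (m : ℝ) ^ k / k.factorial) * (μ / m) ^ m := by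
        rw [Finset.sum_mul]
    _ ≤ Real.exp m / 2 * (μ / m) ^ m := by
        gcongr
        exact sum_pow_div_factorial_le_half_exp m
    _ = _ := by ring

/-- Stirling's lower bound, in the form of an upper bound for the term `μ ^ m / m!`. -/
lemma pow_div_factorial_le_stirling (m : ℕ) (hm : 0 < m) {μ : ℝ} (hμ : 0 ≤ μ) :
    μ ^ m / m.factorial ≤ 1 / √(2 * π * m) * (Real.exp m * (μ / m) ^ m) := by
  have hm0 : (0 : ℝ) < m := by exact_mod_cast hm
  have hst := Stirling.le_factorial_stirling m
  calc μ ^ m / (m.factorial : ℝ) ≤ μ ^ m / (√(2 * π * m) * (m / Real.exp 1) ^ m) := by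
        gcongr
    _ = _ := by
        rw [div_pow, div_pow, ← Real.exp_nat_mul, mul_one]
        field_simp

/-- The left tail bound for a Poisson variable of mean `μ` at an integer `m ≤ μ`. -/
lemma sum_pow_div_factorial_le_min (m : ℕ) (hm : 0 < m) {μ : ℝ} (hμ : (m : ℝ) ≤ μ) :
    ∑ k ∈ Finset.range (m + 1), μ ^ k / k.factorial ≤
      (min (μ / ((μ - m + 1) * √(2 * π * m))) (1 / 2) + 1 / √(2 * π * m))
        * (Real.exp m * (μ / m) ^ m) := by
  have hm0 : (0 : ℝ) < m := by exact_mod_cast hm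
  have hμ0 : 0 < μ := hm0.trans_le hμ
  have hd : 0 < μ - m + 1 := by linarith
  have hst := pow_div_factorial_le_stirling m hm hμ0.le
  rw [Finset.sum_range_succ, add_mul]
  refine add_le_add ?_ hst
  rw [min_mul_of_nonneg _ _ (by positivity)]
  refine le_min ?_ (sum_pow_div_factorial_le_half m hm hμ)
  calc ∑ k ∈ Finset.range m, μ ^ k / (k.factorial : ℝ)
      ≤ m * (μ ^ m / m.factorial) / (μ - m + 1) :=
        (le_div_iff₀ hd).mpr (sum_pow_div_factorial_mul_le m hμ0.le)
    _ ≤ μ * (1 / √(2 * π * m) * (Real.exp m * (μ / m) ^ m)) / (μ - m + 1) := by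
        gcongr
    _ = _ := by
        field_simp

lemma tsum_poissonProb_le_eq_sum (lam : ℝ) {b : ℝ} (hb : 0 ≤ b) :
    (∑' k : ℕ, if (k : ℝ) ≤ b then poissonProb lam k else 0)
      = Real.exp (-lam) * ∑ k ∈ Finset.range (⌊b⌋₊ + 1), lam ^ k / k.factorial := by
  rw [tsum_eq_sum (s := Finset.range (⌊b⌋₊ + 1)), Finset.mul_sum]
  · refine Finset.sum_congr rfl fun k hk => ?_
    rw [if_pos ((Nat.le_floor_iff hb).mp (Finset.mem_range_succ_iff.mp hk)), poissonProb]
    ring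
  · intro k hk
    rw [if_neg]
    rwa [← Nat.le_floor_iff hb, ← Finset.mem_range_succ_iff]

lemma exp_neg_mul_H (n m : ℕ) (hn : 0 < n) (hm : 0 < m) {x : ℝ} (hx : 0 < x) :
    Real.exp (-(n : ℝ) * H (m / n) x)
      = Real.exp (-(n * x)) * (Real.exp m * (n * x / m) ^ m) := by
  have hn0 : (0 : ℝ) < n := by exact_mod_cast hn
  have hm0 : (0 : ℝ) < m := by exact_mod_cast hm
  have hpos : 0 < n * x / m := by positivity
  have hinv : (m : ℝ) / n / x = (n * x / m)⁻¹ := by field_simp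
  rw [← Real.exp_log (pow_pos hpos m), ← Real.exp_add, ← Real.exp_add, Real.log_pow, H, hinv,
    Real.log_inv]
  congr 1
  field_simp
  ring

theorem poisson_left_tail_upper (n : ℕ) (hn : 0 < n) (a x : ℝ) (ha : 1 / n ≤ a) (hax : a ≤ x)
    (α : ℝ) (hα : α = (⌊(n : ℝ) * a⌋ : ℝ) / n) :
    (∑' k : ℕ, if (k : ℝ) ≤ (n : ℝ) * a then poissonProb ((n : ℝ) * x) k else 0) ≤
      (min (x / ((x - α + 1 / n) * Real.sqrt (2 * π * n * α))) (1 / 2)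
          + 1 / Real.sqrt (2 * π * n * α)) * Real.exp (-(n : ℝ) * H α x) := by
  have hn0 : (0 : ℝ) < n := by exact_mod_cast hn
  have hna : 1 ≤ (n : ℝ) * a := by
    rwa [div_le_iff₀ hn0, mul_comm] at ha
  have hna0 : 0 ≤ (n : ℝ) * a := zero_le_one.trans hna
  obtain ⟨m, hm⟩ : ∃ m, m = ⌊(n : ℝ) * a⌋₊ := ⟨_, rfl⟩
  have hmpos : 0 < m := by rw [hm]; exact Nat.floor_pos.mpr hna
  have hm0 : (0 : ℝ) < m := by exact_mod_cast hmpos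
  have hmx : (m : ℝ) ≤ n * x := by
    rw [hm]
    exact (Nat.floor_le hna0).trans (by gcongr)
  have hx : 0 < x := pos_of_mul_pos_right (hm0.trans_le hmx) hn0.le
  have hαm : α = m / n := by
    rw [hα, hm, natCast_floor_eq_intCast_floor hna0]
  have hmean : 2 * π * n * α = 2 * π * m := by rw [hαm]; field_simp
  have hratio : x / ((x - α + 1 / n) * √(2 * π * m))
      = n * x / ((n * x - m + 1) * √(2 * π * m)) := by
    have hd : (n : ℝ) * x - m + 1 = n * (x - α + 1 / n) := by rw [hαm]; field_simp
    rw [hd, mul_assoc (n : ℝ), mul_div_mul_left _ _ hn0.ne']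
  rw [tsum_poissonProb_le_eq_sum _ hna0, hmean, hratio, hαm, exp_neg_mul_H n m hn hmpos hx, ← hm,
    mul_left_comm]
  exact mul_le_mul_of_nonneg_left (sum_pow_div_factorial_le_min m hmpos hmx) (Real.exp_pos _).le
end

section
/- Let a > 0 and s > 0, and let f_s(t) = ((t − a)_-)^s = (max(0, a − t))^s for t ≥ 0. Then lim_{n→∞} n^{s/2}·(S_n f_s(a) − f_s(a)) = a^{s/2}·E(Z_-^s), where Z is a standard normal random variable and (y)_- = max(0, −y); in particular S_n f_s(a) − f_s(a) ∼ (a/n)^{s/2}·E(Z_-^s) as n → ∞, so the convergence at the boundary point a is not exponential. -/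
open Real Filter ProbabilityTheory

/-- The Szász–Mirakyan operator: `S_n f x = E f(N_{nx}/n)`. -/
noncomputable def szasz (n : ℕ) (f : ℝ → ℝ) (x : ℝ) : ℝ :=
  ∑' k : ℕ, f ((k : ℝ) / n) * poissonProb ((n : ℝ) * x) k

open MeasureTheory
open scoped NNReal Topology BoundedContinuousFunction

lemma max_zero_rpow_le_exp {p : ℝ} (hp : 0 < p) (x : ℝ) :
    max 0 x ^ p ≤ p ^ p * Real.exp x := by
  rcases le_total x 0 with hx | hx
  · rw [max_eq_left hx, Real.zero_rpow hp.ne']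
    positivity
  · rw [max_eq_right hx]
    have h : x ≤ p * Real.exp (x / p) := by
      have := Real.add_one_le_exp (x / p)
      calc x = p * (x / p) := by field_simp
        _ ≤ p * Real.exp (x / p) := by gcongr; linarith
    calc x ^ p ≤ (p * Real.exp (x / p)) ^ p := by gcongr
      _ = p ^ p * Real.exp x := by
        rw [Real.mul_rpow hp.le (Real.exp_pos _).le, ← Real.exp_mul, div_mul_cancel₀ _ hp.ne']

lemma exp_neg_sub_one_add_le_sq {u : ℝ} (hu : 0 ≤ u) : Real.exp (-u) - 1 + u ≤ u ^ 2 := by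
  have h : Real.exp (-u) * Real.exp u = 1 := by rw [← Real.exp_add]; simp
  have h1 : Real.exp (-u) * (1 + u) ≤ 1 := by
    rw [← h]
    gcongr
    linarith [Real.add_one_le_exp u]
  have h2 : Real.exp (-u) * (1 + u) ≤ (1 - u + u ^ 2) * (1 + u) := by
    nlinarith [pow_nonneg hu 3]
  linarith [le_of_mul_le_mul_right h2 (by linarith)]

/-- Truncating a nonnegative function at level `M` changes its integral by at most `C / M`, where
`C` bounds the integral of a majorant of its square. -/
lemma abs_integral_sub_integral_min_le {μ : Measure ℝ} [IsProbabilityMeasure μ] {g h : ℝ → ℝ}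
    {C M : ℝ} (hM : 0 < M) (hg : Continuous g) (hg0 : ∀ x, 0 ≤ g x) (hgh : ∀ x, g x ^ 2 ≤ h x)
    (hint : Integrable h μ) (hC : ∫ x, h x ∂μ ≤ C) :
    |∫ x, g x ∂μ - ∫ x, min (g x) M ∂μ| ≤ C / M := by
  have hgi : Integrable g μ := by
    refine ((integrable_const (1 : ℝ)).add hint).mono' hg.aestronglyMeasurable (.of_forall fun x ↦ ?_)
    rw [Real.norm_of_nonneg (hg0 x)]
    simp only [Pi.add_apply]
    nlinarith [hgh x, sq_nonneg (g x - 1), sq_nonneg (g x)]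
  have hmi : Integrable (fun x ↦ min (g x) M) μ := hgi.inf (integrable_const M)
  rw [← integral_sub hgi hmi, abs_of_nonneg (integral_nonneg fun x ↦ by simp)]
  calc ∫ x, (g x - min (g x) M) ∂μ ≤ ∫ x, h x / M ∂μ := by
        refine integral_mono (hgi.sub hmi) (hint.div_const M) fun x ↦ ?_
        simp only
        rw [le_div_iff₀ hM]
        rcases le_total (g x) M with hx | hx
        · rw [min_eq_left hx]
          nlinarith [hgh x, sq_nonneg (g x)]
        · rw [min_eq_right hx]
          nlinarith [hgh x, hg0 x, sq_nonneg M]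
    _ = (∫ x, h x ∂μ) / M := integral_div M h
    _ ≤ C / M := by gcongr

/-- Weak convergence implies convergence of the integrals of an unbounded continuous function whose
square has uniformly bounded integrals. -/
lemma tendsto_integral_of_sq_le {ν : ℕ → ProbabilityMeasure ℝ} {μ : ProbabilityMeasure ℝ}
    (hν : Tendsto ν atTop (𝓝 μ)) {g h : ℝ → ℝ} {C : ℝ} (hg : Continuous g) (hg0 : ∀ x, 0 ≤ g x)
    (hgh : ∀ x, g x ^ 2 ≤ h x) (hint : ∀ n, Integrable h (ν n : Measure ℝ))
    (hC : ∀ n, ∫ x, h x ∂(ν n : Measure ℝ) ≤ C) (hintμ : Integrable h (μ : Measure ℝ))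
    (hCμ : ∫ x, h x ∂(μ : Measure ℝ) ≤ C) :
    Tendsto (fun n ↦ ∫ x, g x ∂(ν n : Measure ℝ)) atTop (𝓝 (∫ x, g x ∂(μ : Measure ℝ))) := by
  rw [Metric.tendsto_atTop]
  intro ε hε
  obtain ⟨M, hM, hMε⟩ : ∃ M : ℝ, 0 < M ∧ C / M < ε / 3 := by
    refine ⟨3 * (|C| + 1) / ε, by positivity, ?_⟩
    rw [div_lt_iff₀ (by positivity)]
    field_simp
    linarith [le_abs_self C]
  let f : ℝ →ᵇ ℝ := BoundedContinuousFunction.ofNormedAddCommGroup (fun x ↦ min (g x) M)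
    (hg.min continuous_const) M fun x ↦ by
      rw [Real.norm_of_nonneg (le_min (hg0 x) hM.le)]
      exact min_le_right _ _
  obtain ⟨N, hN⟩ := Metric.tendsto_atTop.1
    (ProbabilityMeasure.tendsto_iff_forall_integral_tendsto.1 hν f) (ε / 3) (by positivity)
  refine ⟨N, fun n hn ↦ ?_⟩
  have h1 := abs_integral_sub_integral_min_le hM hg hg0 hgh (hint n) (hC n)
  have h2 := abs_integral_sub_integral_min_le hM hg hg0 hgh hintμ hCμ
  have h3 : |∫ x, min (g x) M ∂(ν n : Measure ℝ) - ∫ x, min (g x) M ∂(μ : Measure ℝ)| < ε / 3 :=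
    hN n hn
  rw [Real.dist_eq]
  rw [abs_le] at h1 h2
  rw [abs_lt] at h3 ⊢
  constructor <;> linarith

/-- The law of `(N - r) / √r`, where `N` is Poisson of mean `r`. -/
noncomputable def standardizedPoisson (r : ℝ≥0) : ProbabilityMeasure ℝ :=
  ⟨(poissonMeasure r).map (fun k : ℕ ↦ (√(r : ℝ))⁻¹ * ((k : ℝ) + -(r : ℝ))),
    Measure.isProbabilityMeasure_map .of_discrete⟩

lemma charFun_standardizedPoisson (r : ℝ≥0) (t : ℝ) :
    charFun (standardizedPoisson r : Measure ℝ) t =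
      Complex.exp (r * (Complex.exp (((√(r : ℝ))⁻¹ * t : ℝ) * Complex.I) - 1
        - ((√(r : ℝ))⁻¹ * t : ℝ) * Complex.I)) := by
  have h : (poissonMeasure r).map (fun k : ℕ ↦ (k : ℝ) + -(r : ℝ)) =
      ((poissonMeasure r).map (Nat.cast : ℕ → ℝ)).map (· + -(r : ℝ)) := by
    rw [Measure.map_map (by fun_prop) .of_discrete]
    rfl
  change charFun ((poissonMeasure r).map _) t = _
  rw [charFun_map_mul_comp .of_discrete, h, charFun_map_add_const,
    charFun_map_cast_poissonMeasure, ← Complex.exp_add]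
  congr 1
  simp only [Real.inner_apply]
  push_cast
  ring

lemma tendsto_standardizedPoisson {r : ℕ → ℝ≥0} (hr : Tendsto r atTop atTop) :
    Tendsto (fun n ↦ standardizedPoisson (r n)) atTop
      (𝓝 (⟨gaussianReal 0 1, inferInstance⟩ : ProbabilityMeasure ℝ)) := by
  refine ProbabilityMeasure.tendsto_of_tendsto_charFun fun t ↦ ?_
  simp only [charFun_standardizedPoisson, ProbabilityMeasure.coe_mk, charFun_gaussianReal]
  refine (Complex.continuous_exp.tendsto _).comp ?_
  have hu : Tendsto (fun n ↦ (√(r n : ℝ))⁻¹) atTop (𝓝 0) :=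
    tendsto_inv_atTop_zero.comp (Real.tendsto_sqrt_atTop.comp (NNReal.tendsto_coe_atTop.2 hr))
  have hb : Tendsto (fun n ↦ |t| ^ 3 * (√(r n : ℝ))⁻¹ * Real.exp ((√(r n : ℝ))⁻¹ * |t|)) atTop
      (𝓝 0) := by
    have := (hu.const_mul (|t| ^ 3)).mul
      ((Real.continuous_exp.tendsto _).comp (hu.mul_const |t|))
    simpa using this
  rw [tendsto_iff_norm_sub_tendsto_zero]
  refine squeeze_zero' (.of_forall fun n ↦ norm_nonneg _) ?_ hb
  filter_upwards [hr.eventually_gt_atTop 0] with n hn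
  set u := (√(r n : ℝ))⁻¹ with hu_def
  have hu0 : 0 < u := by positivity
  have hru : (r n : ℝ) * u ^ 2 = 1 := by
    rw [hu_def, inv_pow, Real.sq_sqrt (r n).coe_nonneg]
    exact mul_inv_cancel₀ (by positivity)
  have hruC : (r n : ℂ) * (u : ℂ) ^ 2 = 1 := by exact_mod_cast congrArg ((↑) : ℝ → ℂ) hru
  have hexp := Complex.norm_exp_sub_sum_le_norm_mul_exp (((u * t : ℝ) : ℂ) * Complex.I) 3
  have hnorm : ‖((u * t : ℝ) : ℂ) * Complex.I‖ = u * |t| := by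
    rw [norm_mul, Complex.norm_I, mul_one, Complex.norm_real, Real.norm_eq_abs, abs_mul,
      abs_of_pos hu0]
  rw [hnorm] at hexp
  have heq : ((r n : ℝ) : ℂ) * (Complex.exp (((u * t : ℝ) : ℂ) * Complex.I) - 1
      - ((u * t : ℝ) : ℂ) * Complex.I)
      - (t * ((0 : ℝ) : ℂ) * Complex.I - ((1 : ℝ≥0) : ℝ) * (t : ℂ) ^ 2 / 2) =
      ((r n : ℝ) : ℂ) * (Complex.exp (((u * t : ℝ) : ℂ) * Complex.I)
        - ∑ m ∈ Finset.range 3, (((u * t : ℝ) : ℂ) * Complex.I) ^ m / m.factorial) := by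
    simp only [Finset.sum_range_succ, Finset.sum_range_zero, Nat.factorial, mul_pow, Complex.I_sq]
    push_cast
    linear_combination (-(t : ℂ) ^ 2 / 2) * hruC
  calc _ = ‖((r n : ℝ) : ℂ) * (Complex.exp (((u * t : ℝ) : ℂ) * Complex.I)
        - ∑ m ∈ Finset.range 3, (((u * t : ℝ) : ℂ) * Complex.I) ^ m / m.factorial)‖ := by
        rw [← heq]
    _ ≤ r n * ((u * |t|) ^ 3 * Real.exp (u * |t|)) := by
        rw [norm_mul, Complex.norm_real, Real.norm_of_nonneg (r n).coe_nonneg]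
        gcongr
    _ = |t| ^ 3 * u * Real.exp (u * |t|) := by
        linear_combination (|t| ^ 3 * u * Real.exp (u * |t|)) * hru

lemma hasSum_exp_mul_poisson (r : ℝ≥0) (c : ℝ) :
    HasSum (fun k : ℕ ↦ Real.exp (-r) * r ^ k / k.factorial * Real.exp (c * k))
      (Real.exp (r * (Real.exp c - 1))) := by
  convert! (NormedSpace.expSeries_div_hasSum_exp (r * Real.exp c)).mul_left (Real.exp (-r)) using 1
  · ext k
    rw [mul_pow, ← Real.exp_nat_mul, mul_comm c]
    ring
  · rw [← Real.exp_eq_exp_ℝ, ← Real.exp_add]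
    ring_nf

lemma integrable_exp_mul_poissonMeasure (r : ℝ≥0) (c : ℝ) :
    Integrable (fun k : ℕ ↦ Real.exp (c * k)) (poissonMeasure r) := by
  rw [integrable_poissonMeasure_iff]
  simpa using (hasSum_exp_mul_poisson r c).summable

lemma integral_exp_mul_poissonMeasure (r : ℝ≥0) (c : ℝ) :
    ∫ k : ℕ, Real.exp (c * k) ∂(poissonMeasure r) = Real.exp (r * (Real.exp c - 1)) := by
  rw [integral_poissonMeasure]
  exact (hasSum_exp_mul_poisson r c).tsum_eq

lemma exp_neg_standardized_eq (r : ℝ≥0) (k : ℕ) :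
    Real.exp (-((√(r : ℝ))⁻¹ * ((k : ℝ) + -(r : ℝ)))) =
      Real.exp ((√(r : ℝ))⁻¹ * r) * Real.exp (-(√(r : ℝ))⁻¹ * k) := by
  rw [← Real.exp_add]
  ring_nf

lemma integrable_exp_neg_standardizedPoisson (r : ℝ≥0) :
    Integrable (fun x ↦ Real.exp (-x)) (standardizedPoisson r : Measure ℝ) := by
  change Integrable _ ((poissonMeasure r).map _)
  rw [integrable_map_measure (by fun_prop) .of_discrete]
  simp only [Function.comp_def, exp_neg_standardized_eq]
  exact (integrable_exp_mul_poissonMeasure r _).const_mul _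

lemma integral_exp_neg_standardizedPoisson_le (r : ℝ≥0) :
    ∫ x, Real.exp (-x) ∂(standardizedPoisson r : Measure ℝ) ≤ Real.exp 1 := by
  change ∫ x, Real.exp (-x) ∂((poissonMeasure r).map _) ≤ _
  rw [integral_map .of_discrete (by fun_prop)]
  simp only [exp_neg_standardized_eq]
  rw [integral_const_mul, integral_exp_mul_poissonMeasure, ← Real.exp_add, Real.exp_le_exp]
  set u := (√(r : ℝ))⁻¹ with hu
  have h1 := exp_neg_sub_one_add_le_sq (u := u) (by positivity)
  have h2 : (r : ℝ) * u ^ 2 ≤ 1 := by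
    rw [hu, inv_pow, Real.sq_sqrt r.coe_nonneg]
    exact mul_inv_le_one
  nlinarith [mul_le_mul_of_nonneg_left h1 r.coe_nonneg]

lemma tendsto_integral_negPart_rpow_standardizedPoisson {s : ℝ} (hs : 0 < s) {r : ℕ → ℝ≥0}
    (hr : Tendsto r atTop atTop) :
    Tendsto (fun n ↦ ∫ x, max 0 (-x) ^ s ∂(standardizedPoisson (r n) : Measure ℝ)) atTop
      (𝓝 (∫ x, max 0 (-x) ^ s ∂(gaussianReal 0 1))) := by
  have hexp : Integrable (fun x ↦ Real.exp (-x)) (gaussianReal 0 1) := by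
    simpa using integrable_exp_mul_gaussianReal (μ := 0) (v := 1) (-1)
  refine tendsto_integral_of_sq_le (tendsto_standardizedPoisson hr)
    (h := fun x ↦ (s * 2) ^ (s * 2) * Real.exp (-x))
    (C := (s * 2) ^ (s * 2) * max (Real.exp 1) (∫ x, Real.exp (-x) ∂(gaussianReal 0 1)))
    ?_ (fun x ↦ by positivity) (fun x ↦ ?_)
    (fun n ↦ (integrable_exp_neg_standardizedPoisson (r n)).const_mul _) (fun n ↦ ?_)
    (hexp.const_mul _) ?_
  · exact (continuous_const.max continuous_neg).rpow_const fun _ ↦ Or.inr hs.le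
  · rw [← Real.rpow_mul_natCast (le_max_left _ _)]
    exact_mod_cast max_zero_rpow_le_exp (by positivity) (-x)
  · rw [integral_const_mul]
    gcongr
    exact (integral_exp_neg_standardizedPoisson_le (r n)).trans (le_max_left _ _)
  · rw [integral_const_mul]
    gcongr
    exact le_max_right _ _

lemma integral_negPart_rpow_standardizedPoisson (s : ℝ) (r : ℝ≥0) :
    ∫ x, max 0 (-x) ^ s ∂(standardizedPoisson r : Measure ℝ) =
      ∑' k : ℕ, max 0 (-((√(r : ℝ))⁻¹ * ((k : ℝ) + -(r : ℝ)))) ^ s * poissonProb r k := by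
  change ∫ x, max 0 (-x) ^ s ∂((poissonMeasure r).map _) = _
  rw [integral_map .of_discrete (Measurable.aestronglyMeasurable (by fun_prop)), integral_poissonMeasure]
  refine tsum_congr fun k ↦ ?_
  rw [poissonProb, smul_eq_mul]
  ring

lemma szasz_negPart_rpow {a : ℝ} (ha : 0 < a) (s : ℝ) {n : ℕ} (hn : 0 < n) :
    (n : ℝ) ^ (s / 2) * szasz n (fun t ↦ max 0 (a - t) ^ s) a =
      a ^ (s / 2) *
        ∫ x, max 0 (-x) ^ s ∂(standardizedPoisson (n * a.toNNReal) : Measure ℝ) := by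
  have hn' : (0 : ℝ) < n := by exact_mod_cast hn
  rw [integral_negPart_rpow_standardizedPoisson, szasz, ← tsum_mul_left, ← tsum_mul_left]
  refine tsum_congr fun k ↦ ?_
  simp only [NNReal.coe_mul, NNReal.coe_natCast, Real.coe_toNNReal _ ha.le]
  rw [← mul_assoc, ← mul_assoc]
  congr 1
  have hsq : ∀ x : ℝ, 0 ≤ x → x ^ (s / 2) = √x ^ s := fun x hx ↦ by
    rw [Real.sqrt_eq_rpow, ← Real.rpow_mul hx]
    ring_nf
  rw [hsq _ hn'.le, hsq _ ha.le, ← Real.mul_rpow (Real.sqrt_nonneg _) (le_max_left _ _),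
    ← Real.mul_rpow (Real.sqrt_nonneg _) (le_max_left _ _),
    mul_max_of_nonneg _ _ (Real.sqrt_nonneg _), mul_max_of_nonneg _ _ (Real.sqrt_nonneg _),
    Real.sqrt_mul hn'.le]
  congr 2
  · simp
  · have h1 := Real.sq_sqrt hn'.le
    have h2 : 0 < √(n : ℝ) := Real.sqrt_pos.2 hn'
    have h3 : 0 < √a := Real.sqrt_pos.2 ha
    field_simp
    rw [h1]
    ring

theorem szasz_boundary_rate (a s : ℝ) (ha : 0 < a) (hs : 0 < s) :
    Tendsto
      (fun n : ℕ =>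
        (n : ℝ) ^ (s / 2) * (szasz n (fun t : ℝ => max 0 (a - t) ^ s) a - max 0 (a - a) ^ s))
      atTop
      (nhds (a ^ (s / 2) * ∫ z : ℝ, max 0 (-z) ^ s ∂(gaussianReal 0 1))) := by
  have hr : Tendsto (fun n : ℕ ↦ (n : ℝ≥0) * a.toNNReal) atTop atTop :=
    tendsto_natCast_atTop_atTop.atTop_mul_const (Real.toNNReal_pos.2 ha)
  refine ((tendsto_integral_negPart_rpow_standardizedPoisson hs hr).const_mul _).congr' ?_
  filter_upwards [eventually_gt_atTop 0] with n hn
  rw [sub_self, max_self, Real.zero_rpow hs.ne', sub_zero, szasz_negPart_rpow ha s hn]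
end

section
/- Let n be a positive integer and β > 0 with nβ an integer satisfying nβ ≥ 9. Define x_{β,n} = (β + 1/n)·√(2πnβ)/(2 + √(2πnβ)), and let y_{β,n} be the unique point in (0, β − 1/n) such that πn·H(β − 1/n, y_{β,n}) = 1 (such a point exists since y ↦ πn·H(β − 1/n, y) is strictly decreasing from ∞ to 0 on (0, β − 1/n]). Then y_{β,n} < x_{β,n} < β − 1/n. -/
open Real

theorem Real.log_le_half_sub_inv {v : ℝ} (hv : 1 ≤ v) : Real.log v ≤ (v - v⁻¹) / 2 := by
  rw [← Real.sinh_log (by linarith)]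
  exact Real.self_le_sinh_iff.2 (Real.log_nonneg hv)

theorem two_mul_mul_H_le {t y : ℝ} (hy : 0 < y) (hyt : y ≤ t) :
    2 * y * H t y ≤ (t - y) ^ 2 := by
  have ht : 0 < t := hy.trans_le hyt
  have h := mul_le_mul_of_nonneg_left
    (Real.log_le_half_sub_inv ((one_le_div hy).2 hyt)) (by positivity : 0 ≤ 2 * y * t)
  have e : 2 * y * t * ((t / y - (t / y)⁻¹) / 2) = t ^ 2 - y ^ 2 := by
    field_simp
  rw [e] at h
  unfold H
  nlinarith

/-- The scaled crossing point `(a + 1) s / (2 + s)` with `s = √(2πa)` lies below `a - 1`. -/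
theorem scaled_crossing_lt {a s : ℝ} (ha : 9 ≤ a) (hs : 0 < s) (hs2 : s ^ 2 = 2 * π * a) :
    (a + 1) * s / (2 + s) < a - 1 := by
  have hsa : s < a - 1 := by
    have hpi := Real.pi_lt_d2
    apply lt_of_pow_lt_pow_left₀ 2 (by linarith)
    nlinarith
  rw [div_lt_iff₀ (by linarith)]
  nlinarith

theorem pi_mul_sq_sub_scaled_crossing_lt {a s : ℝ} (ha : 9 ≤ a) (hs : 0 < s)
    (hs2 : s ^ 2 = 2 * π * a) :
    π * (a - 1 - (a + 1) * s / (2 + s)) ^ 2 < 2 * ((a + 1) * s / (2 + s)) := by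
  have hlt := scaled_crossing_lt ha hs hs2
  have hpos : 0 < 2 + s := by linarith
  have hpi := Real.pi_pos
  have e : a - 1 - (a + 1) * s / (2 + s) = 2 * (a - 1 - s) / (2 + s) := by
    field_simp
    ring
  have hsa : 0 < a - 1 - s := by
    have h : 0 < 2 * (a - 1 - s) / (2 + s) := by rw [← e]; linarith
    have := (div_pos_iff_of_pos_right hpos).1 h
    linarith
  have hsq : (a - 1 - s) ^ 2 < a ^ 2 := pow_lt_pow_left₀ (by linarith) hsa.le (by norm_num)
  have key : 2 * π * (a - 1 - s) ^ 2 < (a + 1) * (s ^ 2 + 2 * s) := by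
    have h1 : 2 * π * (a - 1 - s) ^ 2 < 2 * π * a ^ 2 :=
      mul_lt_mul_of_pos_left hsq (by positivity)
    have h2 : 0 < 2 * π * a + (a + 1) * (2 * s) := by positivity
    rw [hs2]
    nlinarith
  rw [e, div_pow, ← mul_div_assoc, ← mul_div_assoc, div_lt_div_iff₀ (by positivity) hpos]
  nlinarith [mul_lt_mul_of_pos_right key hpos]

theorem crossing_points_ordered (n : ℕ) (hn : 0 < n) (β : ℝ) (m : ℕ)
    (hm : (m : ℝ) = (n : ℝ) * β) (hm9 : 9 ≤ m)
    (y : ℝ) (hy0 : 0 < y) (hy1 : y < β - 1 / n) (hy : π * n * H (β - 1 / n) y = 1) :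
    y < (β + 1 / n) * Real.sqrt (2 * π * n * β) / (2 + Real.sqrt (2 * π * n * β)) ∧
    (β + 1 / n) * Real.sqrt (2 * π * n * β) / (2 + Real.sqrt (2 * π * n * β)) < β - 1 / n := by
  have hn' : (0 : ℝ) < n := by exact_mod_cast hn
  have ha : (9 : ℝ) ≤ m := by exact_mod_cast hm9
  have hpi := Real.pi_pos
  have hrad : 2 * π * n * β = 2 * π * m := by rw [hm]; ring
  rw [hrad]
  set s := Real.sqrt (2 * π * m) with hs_def
  have hs : 0 < s := Real.sqrt_pos.2 (by positivity)
  have hs2 : s ^ 2 = 2 * π * m := Real.sq_sqrt (by positivity)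
  set x := (β + 1 / n) * s / (2 + s) with hx_def
  have hnt : n * (β - 1 / n) = m - 1 := by rw [hm]; field_simp
  have hnx : n * x = (m + 1) * s / (2 + s) := by
    rw [hx_def, hm]
    field_simp
  have hlt := scaled_crossing_lt ha hs hs2
  have hkey := pi_mul_sq_sub_scaled_crossing_lt ha hs hs2
  rw [← hnx, ← hnt] at hlt hkey
  have hxt : x < β - 1 / n := lt_of_mul_lt_mul_left hlt hn'.le
  refine ⟨?_, hxt⟩
  by_contra! hxy
  have hH : 2 * y ≤ π * n * (β - 1 / n - y) ^ 2 := by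
    have h := mul_le_mul_of_nonneg_left (two_mul_mul_H_le hy0 hy1.le)
      (by positivity : 0 ≤ π * n)
    calc 2 * y = 2 * y * (π * n * H (β - 1 / n) y) := by rw [hy, mul_one]
      _ = π * n * (2 * y * H (β - 1 / n) y) := by ring
      _ ≤ _ := h
  have hsq : (β - 1 / n - y) ^ 2 ≤ (β - 1 / n - x) ^ 2 :=
    pow_le_pow_left₀ (by linarith) (by linarith) 2
  have hx : 2 * x ≤ π * n * (β - 1 / n - x) ^ 2 := by
    have := mul_le_mul_of_nonneg_left hsq (by positivity : 0 ≤ π * n)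
    linarith
  have := mul_le_mul_of_nonneg_left hx hn'.le
  nlinarith
end
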